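/- For p(t) = 1 + t + t^{m+1} with m ≥ 2 and F(t) = (1+t)^m, the product F·p has exactly 2m + 2 non-zero coefficients, and 2m + 2 > m + 3. -/

import Mathlib

open Polynomial

theorem stmt_10 (m : ℕ) (hm : 2 ≤ m) :
    ((1 + X : Polynomial ℝ) ^ m * (1 + X + X ^ (m + 1))).support.card = 2 * m + 2 ∧
      2 * m + 2 > m + 3 := by
  refine ⟨?_, by omega⟩
  have h : ((1 + X : Polynomial ℝ) ^ m * (1 + X + X ^ (m + 1)))
      = (1 + X) ^ (m + 1) + (1 + X) ^ m * X ^ (m + 1) := by ring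
  have hs : ((1 + X : Polynomial ℝ) ^ m * (1 + X + X ^ (m + 1))).support
      = Finset.range (2 * m + 2) := by
    ext k
    rw [h, mem_support_iff, coeff_add, coeff_mul_X_pow', coeff_one_add_X_pow,
      Finset.mem_range]
    split_ifs with hk
    · rw [coeff_one_add_X_pow, ← Nat.cast_add, Nat.cast_ne_zero]
      constructor
      · intro h1
        by_contra h2
        apply h1
        rw [Nat.choose_eq_zero_of_lt (by omega), Nat.choose_eq_zero_of_lt (by omega)]
      · intro h1
        have := Nat.choose_pos (n := m) (k := k - (m + 1)) (by omega)
        omega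
    · rw [add_zero, Nat.cast_ne_zero]
      have := Nat.choose_pos (n := m + 1) (k := k) (by omega)
      omega
  rw [hs, Finset.card_range]
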